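/- Let c > 0, η > 0, γ ≥ 0 with γ² < cη, and T ∈ ℝ. Define a : ℝ → ℝ by a(t) = (√(cη)/2) · tanh( artanh(γ/√(cη)) + √(η/c)·(T − t) ), and b : ℝ → ℝ by b(t) = √(cη/(cη − γ²)) / cosh( √(η/c)·(t − T) − artanh(γ/√(cη)) ) − 1. Then b is differentiable on ℝ, b(T) = 0, and b satisfies b'(t) = (2/c)·a(t)·(b(t) + 1) for all t ∈ ℝ. -/

import Mathlib

/- STATEMENT 13: With
   a(t) = (√(cη)/2)·tanh( artanh(γ/√(cη)) + √(η/c)·(T−t) ) and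
   b(t) = √(cη/(cη−γ²)) / cosh( √(η/c)·(t−T) − artanh(γ/√(cη)) ) − 1,
   b is differentiable, b(T) = 0 and b' = (2/c)·a·(b+1). -/

noncomputable section

/-- Inverse hyperbolic tangent on (−1,1). -/
def artanh (x : ℝ) : ℝ := Real.log ((1 + x) / (1 - x)) / 2

theorem lq_coefficient_a24
    (c η γ T : ℝ) (hc : 0 < c) (hη : 0 < η) (hγ : 0 ≤ γ) (hγ2 : γ ^ 2 < c * η)
    (a b : ℝ → ℝ)
    (ha : ∀ t, a t = Real.sqrt (c * η) / 2 *
      Real.tanh (artanh (γ / Real.sqrt (c * η)) + Real.sqrt (η / c) * (T - t)))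
    (hb : ∀ t, b t = Real.sqrt (c * η / (c * η - γ ^ 2)) /
      Real.cosh (Real.sqrt (η / c) * (t - T) - artanh (γ / Real.sqrt (c * η))) - 1) :
    Differentiable ℝ b ∧ b T = 0 ∧
      ∀ t : ℝ, deriv b t = 2 / c * a t * (b t + 1) := by
  have hcη : 0 < c * η := mul_pos hc hη
  have hs : 0 < Real.sqrt (c * η) := Real.sqrt_pos.mpr hcη
  have hs2 : Real.sqrt (c * η) ^ 2 = c * η := Real.sq_sqrt hcη.le
  have hw : Real.sqrt (η / c) = Real.sqrt (c * η) / c := by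
    rw [Real.sqrt_eq_iff_mul_self_eq (by positivity) (by positivity)]
    rw [div_mul_div_comm, ← pow_two, hs2]
    field_simp
  have hx0 : 0 ≤ γ / Real.sqrt (c * η) := by positivity
  have hx1 : γ / Real.sqrt (c * η) < 1 := by
    rw [div_lt_one hs]
    exact Real.lt_sqrt_of_sq_lt hγ2
  have hx : γ / Real.sqrt (c * η) ∈ Set.Ioo (-1 : ℝ) 1 := ⟨by linarith, hx1⟩
  have hart : artanh (γ / Real.sqrt (c * η)) = Real.artanh (γ / Real.sqrt (c * η)) := by
    rw [Real.artanh_eq_half_log ⟨hx.1.le, hx.2.le⟩, artanh]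
    ring
  have hd : ∀ t, HasDerivAt b (2 / c * a t * (b t + 1)) t := by
    intro t
    have hbf : b = fun t => Real.sqrt (c * η / (c * η - γ ^ 2)) /
      Real.cosh (Real.sqrt (η / c) * (t - T) - artanh (γ / Real.sqrt (c * η))) - 1 := funext hb
    have h1 : HasDerivAt (fun t : ℝ => Real.sqrt (η / c) * (t - T)
        - artanh (γ / Real.sqrt (c * η))) (Real.sqrt (η / c) * 1) t :=
      (((hasDerivAt_id t).sub_const T).const_mul _).sub_const _
    have hne := (Real.cosh_pos (Real.sqrt (η / c) * (t - T)
        - artanh (γ / Real.sqrt (c * η)))).ne'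
    have h2 := ((hasDerivAt_const t (Real.sqrt (c * η / (c * η - γ ^ 2)))).div
      h1.cosh hne).sub_const 1
    rw [ha, hb]
    have harg : artanh (γ / Real.sqrt (c * η)) + Real.sqrt (η / c) * (T - t)
      = -(Real.sqrt (η / c) * (t - T) - artanh (γ / Real.sqrt (c * η))) := by ring
    rw [harg, Real.tanh_neg, Real.tanh_eq_sinh_div_cosh, hbf]
    refine h2.congr_deriv ?_
    generalize Real.sqrt (η / c) * (t - T) - artanh (γ / Real.sqrt (c * η)) = u at *
    rw [hw]
    field_simp
    ring
  refine ⟨fun t => (hd t).differentiableAt, ?_, fun t => (hd t).deriv⟩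
  rw [hb, hart, sub_self, mul_zero, zero_sub, Real.cosh_neg, Real.cosh_artanh hx]
  have h3 : c * η / (c * η - γ ^ 2) = (1 - (γ / Real.sqrt (c * η)) ^ 2)⁻¹ := by
    have : c * η - γ ^ 2 ≠ 0 := by linarith
    rw [div_pow, hs2, ← inv_div]
    congr 1
    field_simp
  have h4 : 0 < 1 - (γ / Real.sqrt (c * η)) ^ 2 := by nlinarith
  have h5 := (Real.sqrt_pos.mpr h4).ne'
  rw [h3, Real.sqrt_inv]
  rw [one_div, div_self (inv_ne_zero h5), sub_self]
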